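/- arXiv:2209.11617 — 2 statements merged into one kernel-verified Lean document; each statement's English description precedes it below -/
import Mathlib

section
/- Let G be a simple undirected graph on N vertices in which every vertex has positive degree, let α, δ ∈ ℝ, and let W = (α+δ)·Δ⁻¹·(A∘A² + A)·Δ⁻¹ − (δ/2)·(Δ⁻¹·A + A·Δ⁻¹). If the sequence of position vectors x[k] ∈ ℝ^N satisfies, for every vertex i and every k ≥ 0, x_i[k+1] = x_i[k] + Σ_{j ∈ N_i} ( α·(|N_j ∩ N_i| + 1) − (δ/2)·(|N_j \ N_i| + |N_i \ N_j| − 2) ) / (d_j·d_i) · ( x_j[k] − x_i[k] ), then x[k+1] = ( I + W − diag(W·u) ) · x[k] for every k ≥ 0, where u is the all-one vector. -/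
open Matrix Finset

/-- The LCP matrix `W = (α+δ)·Δ⁻¹·(A∘A² + A)·Δ⁻¹ − (δ/2)·(Δ⁻¹·A + A·Δ⁻¹)`. -/
noncomputable def lcpW {N : ℕ} (G : SimpleGraph (Fin N)) [DecidableRel G.Adj] (α δ : ℝ) :
    Matrix (Fin N) (Fin N) ℝ :=
  (α + δ) • ((Matrix.diagonal fun i => (G.degree i : ℝ))⁻¹ *
      (Matrix.hadamard (G.adjMatrix ℝ) (G.adjMatrix ℝ ^ 2) + G.adjMatrix ℝ) *
      (Matrix.diagonal fun i => (G.degree i : ℝ))⁻¹) -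
    (δ / 2) • ((Matrix.diagonal fun i => (G.degree i : ℝ))⁻¹ * G.adjMatrix ℝ +
      G.adjMatrix ℝ * (Matrix.diagonal fun i => (G.degree i : ℝ))⁻¹)

/-- The number of common neighbours is the corresponding entry of the squared adjacency matrix. -/
lemma adjMatrix_sq_apply {V : Type*} [Fintype V] [DecidableEq V] (G : SimpleGraph V)
    [DecidableRel G.Adj] (i j : V) :
    (G.adjMatrix ℝ ^ 2) i j = ((G.neighborFinset j ∩ G.neighborFinset i).card : ℝ) := by
  rw [pow_two, SimpleGraph.adjMatrix_mul_apply]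
  simp only [SimpleGraph.adjMatrix_apply, Finset.sum_boole]
  congr 2
  ext v
  simp [G.adj_comm v j, and_comm]

lemma diagonal_degree_inv {V : Type*} [Fintype V] [DecidableEq V] (G : SimpleGraph V)
    [DecidableRel G.Adj] (hd : ∀ i, 0 < G.degree i) :
    (Matrix.diagonal fun i => (G.degree i : ℝ))⁻¹ =
      Matrix.diagonal fun i => (G.degree i : ℝ)⁻¹ := by
  refine Matrix.inv_eq_right_inv ?_
  rw [Matrix.diagonal_mul_diagonal, ← Matrix.diagonal_one]
  congr 1
  funext i
  exact mul_inv_cancel₀ (Nat.cast_ne_zero.mpr (Nat.pos_iff_ne_zero.mp (hd i)))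

/-- The entries of `lcpW` are the coefficients of the node-level equation on edges, and vanish
elsewhere. -/
lemma lcpW_apply {N : ℕ} (G : SimpleGraph (Fin N)) [DecidableRel G.Adj]
    (α δ : ℝ) (hd : ∀ i, 0 < G.degree i) (i j : Fin N) :
    lcpW G α δ i j = if G.Adj i j then
      (α * (((G.neighborFinset j ∩ G.neighborFinset i).card : ℝ) + 1) -
        δ / 2 * (((G.neighborFinset j \ G.neighborFinset i).card : ℝ) +
          ((G.neighborFinset i \ G.neighborFinset j).card : ℝ) - 2)) /
        ((G.degree j : ℝ) * (G.degree i : ℝ)) else 0 := by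
  have hi : (G.degree i : ℝ) ≠ 0 := Nat.cast_ne_zero.mpr (Nat.pos_iff_ne_zero.mp (hd i))
  have hj : (G.degree j : ℝ) ≠ 0 := Nat.cast_ne_zero.mpr (Nat.pos_iff_ne_zero.mp (hd j))
  have hji : ((G.neighborFinset j \ G.neighborFinset i).card : ℝ) =
      G.degree j - ((G.neighborFinset j ∩ G.neighborFinset i).card : ℝ) := by
    rw [eq_sub_iff_add_eq, ← G.card_neighborFinset_eq_degree]
    exact_mod_cast Finset.card_sdiff_add_card_inter _ _
  have hij : ((G.neighborFinset i \ G.neighborFinset j).card : ℝ) =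
      G.degree i - ((G.neighborFinset j ∩ G.neighborFinset i).card : ℝ) := by
    rw [eq_sub_iff_add_eq, ← G.card_neighborFinset_eq_degree, Finset.inter_comm]
    exact_mod_cast Finset.card_sdiff_add_card_inter _ _
  rw [lcpW, diagonal_degree_inv G hd, hji, hij]
  simp only [Matrix.sub_apply, Matrix.add_apply, Matrix.smul_apply, Matrix.mul_diagonal,
    Matrix.diagonal_mul, Matrix.hadamard_apply, adjMatrix_sq_apply, SimpleGraph.adjMatrix_apply,
    smul_eq_mul]
  split_ifs
  · field_simp
    ring
  · simp

/-- If the position vectors `x[k]` satisfy the node-level governing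
equation of the linear clustering process, then they satisfy the matrix difference
equation `x[k+1] = (I + W − diag(W·u))·x[k]`. -/
theorem stmt_3 {N : ℕ} (G : SimpleGraph (Fin N)) [DecidableRel G.Adj]
    (α δ : ℝ) (hd : ∀ i, 0 < G.degree i) (x : ℕ → Fin N → ℝ)
    (hx : ∀ (i : Fin N) (k : ℕ),
      x (k + 1) i = x k i + ∑ j ∈ G.neighborFinset i,
        (α * (((G.neighborFinset j ∩ G.neighborFinset i).card : ℝ) + 1) -
          δ / 2 * (((G.neighborFinset j \ G.neighborFinset i).card : ℝ) +
            ((G.neighborFinset i \ G.neighborFinset j).card : ℝ) - 2)) /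
          ((G.degree j : ℝ) * (G.degree i : ℝ)) * (x k j - x k i)) :
    ∀ k : ℕ,
      x (k + 1) =
        (1 + lcpW G α δ -
            Matrix.diagonal (lcpW G α δ *ᵥ fun _ => (1 : ℝ))) *ᵥ x k := by
  intro k
  funext i
  rw [hx i k, Matrix.sub_mulVec, Matrix.add_mulVec, Matrix.one_mulVec, Pi.sub_apply, Pi.add_apply,
    Matrix.mulVec_diagonal, add_sub_assoc]
  congr 1
  simp only [Matrix.mulVec, dotProduct, mul_one]
  rw [Finset.sum_mul, ← Finset.sum_sub_distrib, G.neighborFinset_eq_filter, Finset.sum_filter]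
  refine Finset.sum_congr rfl fun j _ => ?_
  rw [lcpW_apply G α δ hd]
  split_ifs
  · simp only [G.neighborFinset_eq_filter, mul_sub]
  · simp
end

section
/- Let M be an N×N real symmetric matrix satisfying M·u = 0 (u the all-one vector), with orthonormal eigenbasis y₁ = u/√N, y₂, …, y_N and corresponding eigenvalues β₁ = 0, β₂, …, β_N. Let x[k] = (I + M)^k · x[0]. If 1 + β₂ ≠ 0, |1 + β₂| > |1 + β_j| for all j ≥ 3, and y₂ᵀ·x[0] ≠ 0, then the normalized shifted position vector ( x[k] − (uᵀ·x[0]/N)·u ) / ( (1 + β₂)^k · (y₂ᵀ·x[0]) ) converges to the eigenvector y₂ as k → ∞. -/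
open Matrix Finset Filter

/-- A vector is the sum of its components along an orthonormal family of full size. -/
theorem sum_dotProduct_smul_of_orthonormal {n : Type*} [Fintype n] [DecidableEq n]
    {y : n → n → ℝ} (hy : ∀ i j, y i ⬝ᵥ y j = if i = j then 1 else 0) (v : n → ℝ) :
    ∑ j, (y j ⬝ᵥ v) • y j = v := by
  have hmul : Matrix.of y * (Matrix.of y)ᵀ = 1 := by
    ext i j
    rw [Matrix.mul_apply', Matrix.one_apply]
    exact hy i j
  have hv : (Matrix.of y)ᵀ *ᵥ (Matrix.of y *ᵥ v) = v := by
    rw [Matrix.mulVec_mulVec, mul_eq_one_comm.mp hmul, Matrix.one_mulVec]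
  rw [Matrix.mulVec_eq_sum] at hv
  simp only [Matrix.transpose_transpose, op_smul_eq_smul] at hv
  exact hv

/-- An eigenvector of `M` for `b` is an eigenvector of `(1 + M) ^ k` for `(1 + b) ^ k`. -/
theorem one_add_pow_mulVec_of_eigenvector {n : Type*} [Fintype n] [DecidableEq n]
    {M : Matrix n n ℝ} {w : n → ℝ} {b : ℝ} (h : M *ᵥ w = b • w) (k : ℕ) :
    ((1 + M) ^ k) *ᵥ w = (1 + b) ^ k • w := by
  induction k with
  | zero => simp
  | succ k ih =>
    have hw : (1 + M) *ᵥ w = (1 + b) • w := by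
      rw [Matrix.add_mulVec, Matrix.one_mulVec, h, add_smul, one_smul]
    rw [pow_succ, ← Matrix.mulVec_mulVec, hw, Matrix.mulVec_smul, ih, smul_smul, pow_succ']

/-- Let `M` be a real symmetric `N×N` matrix with `M·u = 0`, with an
orthonormal eigenbasis `y₁ = u/√N, y₂, …, y_N` and eigenvalues `β₁ = 0, β₂, …, β_N`, and
let `x[k] = (I + M)^k·x[0]`.  If `1 + β₂ ≠ 0`, `|1 + β_j| < |1 + β₂|` for all `j ≥ 3`, and
`y₂ᵀ·x[0] ≠ 0`, then `(x[k] − (uᵀx[0]/N)·u)/((1 + β₂)^k·(y₂ᵀ·x[0]))` converges to the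
eigenvector `y₂` as `k → ∞`. -/
theorem stmt_14 {N : ℕ} (hN : 1 < N) (M : Matrix (Fin N) (Fin N) ℝ) (hsym : M.IsSymm)
    (hMu : M *ᵥ (fun _ => (1 : ℝ)) = 0)
    (y : Fin N → Fin N → ℝ) (β : Fin N → ℝ)
    (hortho : ∀ i j : Fin N, y i ⬝ᵥ y j = if i = j then 1 else 0)
    (heig : ∀ j : Fin N, M *ᵥ y j = β j • y j)
    (hy1 : y ⟨0, by omega⟩ = fun _ => (Real.sqrt N)⁻¹)
    (hβ1 : β ⟨0, by omega⟩ = 0)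
    (h2 : 1 + β ⟨1, hN⟩ ≠ 0)
    (hgap : ∀ j : Fin N, 2 ≤ (j : ℕ) → |1 + β j| < |1 + β ⟨1, hN⟩|)
    (x : ℕ → Fin N → ℝ)
    (hx : ∀ k : ℕ, x k = ((1 + M) ^ k) *ᵥ x 0)
    (hproj : y ⟨1, hN⟩ ⬝ᵥ x 0 ≠ 0) :
    Tendsto
      (fun k : ℕ =>
        ((1 + β ⟨1, hN⟩) ^ k * (y ⟨1, hN⟩ ⬝ᵥ x 0))⁻¹ •
          (x k - ((((fun _ => (1 : ℝ)) ⬝ᵥ x 0) / N) • fun _ => (1 : ℝ))))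
      atTop (nhds (y ⟨1, hN⟩)) := by
  have hN0 : 0 < N := by omega
  have hsqrt : (Real.sqrt N)⁻¹ * (Real.sqrt N)⁻¹ = (N : ℝ)⁻¹ := by
    rw [← mul_inv, Real.mul_self_sqrt (Nat.cast_nonneg N)]
  have hmean : (((fun _ => (1 : ℝ)) ⬝ᵥ x 0) / N) • (fun _ => (1 : ℝ)) =
      (y ⟨0, hN0⟩ ⬝ᵥ x 0) • y ⟨0, hN0⟩ := by
    have hu : y ⟨0, hN0⟩ = (Real.sqrt N)⁻¹ • fun _ => (1 : ℝ) := by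
      rw [hy1]; ext i; simp
    rw [hu, smul_dotProduct, smul_smul, smul_eq_mul, mul_right_comm, hsqrt, div_eq_inv_mul]
  have hexp : ∀ k, x k = ∑ j, ((1 + β j) ^ k * (y j ⬝ᵥ x 0)) • y j := fun k => by
    conv_lhs => rw [hx k, ← sum_dotProduct_smul_of_orthonormal hortho (x 0)]
    rw [Matrix.mulVec_sum]
    refine Finset.sum_congr rfl fun j _ => ?_
    rw [Matrix.mulVec_smul, one_add_pow_mulVec_of_eigenvector (heig j), smul_smul, mul_comm]
  have hshift : ∀ k, ((1 + β ⟨1, hN⟩) ^ k * (y ⟨1, hN⟩ ⬝ᵥ x 0))⁻¹ •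
      (x k - ((((fun _ => (1 : ℝ)) ⬝ᵥ x 0) / N) • fun _ => (1 : ℝ))) =
      ∑ j ∈ univ.erase ⟨0, hN0⟩, (((1 + β j) / (1 + β ⟨1, hN⟩)) ^ k *
        ((y j ⬝ᵥ x 0) / (y ⟨1, hN⟩ ⬝ᵥ x 0))) • y j := fun k => by
    rw [hmean, hexp k, ← Finset.add_sum_erase _ _ (mem_univ (⟨0, hN0⟩ : Fin N)), hβ1,
      add_zero, one_pow, one_mul, add_sub_cancel_left, Finset.smul_sum]
    refine Finset.sum_congr rfl fun j _ => ?_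
    rw [smul_smul, div_pow, div_mul_div_comm, div_eq_inv_mul]
  have hlim : y ⟨1, hN⟩ = ∑ j ∈ univ.erase (⟨0, hN0⟩ : Fin N),
      (if j = ⟨1, hN⟩ then (1 : ℝ) else 0) • y j := by
    simp [ite_smul, Finset.sum_ite_eq']
  simp_rw [hshift]
  rw [hlim]
  refine tendsto_finsetSum _ fun j hj => Tendsto.smul_const ?_ _
  split_ifs with hj1
  · subst hj1
    simp [div_self h2, div_self hproj]
  · have hj2 : 2 ≤ (j : ℕ) := by
      have h0 := Finset.ne_of_mem_erase hj
      simp only [ne_eq, Fin.ext_iff] at h0 hj1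
      omega
    have hratio : |(1 + β j) / (1 + β ⟨1, hN⟩)| < 1 := by
      rw [abs_div, div_lt_one (abs_pos.mpr h2)]
      exact hgap j hj2
    simpa using (tendsto_pow_atTop_nhds_zero_of_abs_lt_one hratio).mul_const
      ((y j ⬝ᵥ x 0) / (y ⟨1, hN⟩ ⬝ᵥ x 0))
end
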